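/- arXiv:2410.23376 — 2 statements merged into one kernel-verified Lean document; each statement's English description precedes it below -/
import Mathlib

section
/- The supremum of the set {x : ℝ | ∃ R an 8×8 PSD matrix with (I₄ − Tr₂R) PSD, R satisfying the perfect retrieval condition, and x = Re(trace(R·D))} equals the supremum of the set {x : ℝ | ∃ A B : Matrix (Fin 2) (Fin 2) ℂ, A PSD ∧ B PSD ∧ (I₂ − A − B) PSD ∧ ⟨v|A|v⟩ = 0 ∧ ⟨u|B|u⟩ = 0 ∧ x = Re(⟨u|A|u⟩ + ⟨v|B|v⟩)}. (Proposition 2 of the paper, perfect probabilistic case: optimization of the retrieval is equivalent to an unambiguous state discrimination problem.) -/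
open Matrix Kronecker Complex Filter
open scoped ComplexOrder

noncomputable section

/-- Outer product `v vᴴ`. -/
def outer {ι : Type*} [Fintype ι] (v : ι → ℂ) : Matrix ι ι ℂ :=
  Matrix.vecMulVec v (star v)

/-- The conjugated memory states `ψ*₀ = (e^{-inα}, e^{inα})/√2`, `ψ*₁ = (e^{inα}, e^{-inα})/√2`. -/
def psiStar (n : ℕ) (α : ℝ) (i : Fin 2) : Fin 2 → ℂ :=
  if i = 0 then
    ((Real.sqrt 2 : ℂ))⁻¹ • ![Complex.exp (-(Complex.I * n * α)), Complex.exp (Complex.I * n * α)]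
  else
    ((Real.sqrt 2 : ℂ))⁻¹ • ![Complex.exp (Complex.I * n * α), Complex.exp (-(Complex.I * n * α))]

/-- `|U⟩⟩ = (e^{iε},0,0,e^{-iε})` in `ℂ^{Fin 2 × Fin 2}`. -/
def Uket (ε : ℝ) : Fin 2 × Fin 2 → ℂ := fun p =>
  if p = (0, 0) then Complex.exp (Complex.I * ε)
  else if p = (1, 1) then Complex.exp (-(Complex.I * ε)) else 0

/-- `|U₀⟩⟩` and `|U₁⟩⟩`. -/
def Ui (α : ℝ) (i : Fin 2) : Fin 2 × Fin 2 → ℂ :=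
  if i = 0 then Uket α else Uket (-α)

/-- The performance operator `D = (1/8) ∑ᵢ (ψ*ᵢ ψ*ᵢᴴ) ⊗ₖ |Uᵢ⟩⟩⟨⟨Uᵢ|`. -/
def Dop (n : ℕ) (α : ℝ) : Matrix (Fin 2 × Fin 2 × Fin 2) (Fin 2 × Fin 2 × Fin 2) ℂ :=
  (1/8 : ℂ) • ∑ i : Fin 2, (outer (psiStar n α i)) ⊗ₖ (outer (Ui α i))

/-- Partial trace over the third (output) factor `H₂`. -/
def ptr2 (R : Matrix (Fin 2 × Fin 2 × Fin 2) (Fin 2 × Fin 2 × Fin 2) ℂ) :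
    Matrix (Fin 2 × Fin 2) (Fin 2 × Fin 2) ℂ :=
  Matrix.of fun p q => ∑ k : Fin 2, R (p.1, p.2, k) (q.1, q.2, k)

/-- Partial sandwich `⟨w|R|w⟩` over the first (memory) factor `H₀`. -/
def sand (w : Fin 2 → ℂ)
    (R : Matrix (Fin 2 × Fin 2 × Fin 2) (Fin 2 × Fin 2 × Fin 2) ℂ) :
    Matrix (Fin 2 × Fin 2) (Fin 2 × Fin 2) ℂ :=
  Matrix.of fun p q => ∑ a : Fin 2, ∑ a' : Fin 2,
    (starRingEnd ℂ) (w a) * R (a, p.1, p.2) (a', q.1, q.2) * w a'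

/-- The vector `u = (cₙ·c, sₙ·s)`. -/
def uvec (n : ℕ) (α : ℝ) : Fin 2 → ℂ :=
  ![((Real.cos (n * α) * Real.cos α : ℝ) : ℂ), ((Real.sin (n * α) * Real.sin α : ℝ) : ℂ)]

/-- The vector `v = (cₙ·s, -sₙ·c)`. -/
def vvec (n : ℕ) (α : ℝ) : Fin 2 → ℂ :=
  ![((Real.cos (n * α) * Real.sin α : ℝ) : ℂ), ((-(Real.sin (n * α) * Real.cos α) : ℝ) : ℂ)]

/-- `⟨w|A|w⟩ = star w ⬝ᵥ A.mulVec w`. -/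
def brk (w : Fin 2 → ℂ) (A : Matrix (Fin 2) (Fin 2) ℂ) : ℂ :=
  star w ⬝ᵥ A.mulVec w

/-- The perfect retrieval condition: `⟨ψ*ᵢ|R|ψ*ᵢ⟩ = λᵢ |Uᵢ⟩⟩⟨⟨Uᵢ|` for some `λ₀, λ₁ ≥ 0`. -/
def PerfectRetrieval (n : ℕ) (α : ℝ)
    (R : Matrix (Fin 2 × Fin 2 × Fin 2) (Fin 2 × Fin 2 × Fin 2) ℂ) : Prop :=
  ∃ lam0 lam1 : ℝ, 0 ≤ lam0 ∧ 0 ≤ lam1 ∧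
    sand (psiStar n α 0) R = (lam0 : ℂ) • outer (Ui α 0) ∧
    sand (psiStar n α 1) R = (lam1 : ℂ) • outer (Ui α 1)

section

variable {ι : Type*} [Fintype ι]

lemma quad_outer (f z : ι → ℂ) :
    star z ⬝ᵥ (outer f *ᵥ z) = ((normSq (star f ⬝ᵥ z) : ℝ) : ℂ) := by
  have h : star z ⬝ᵥ f = (starRingEnd ℂ) (star f ⬝ᵥ z) := by
    simp [dotProduct, mul_comm]
  rw [outer, vecMulVec_mulVec, dotProduct_smul, h, normSq_eq_conj_mul_self]
  simp [mul_comm]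

lemma star_dotProduct_self_eq_sum_normSq (z : ι → ℂ) :
    star z ⬝ᵥ z = ((∑ i, normSq (z i) : ℝ) : ℂ) := by
  simp [dotProduct, normSq_eq_conj_mul_self]

lemma outer_posSemidef (f : ι → ℂ) : (outer f).PosSemidef :=
  posSemidef_vecMulVec_self_star f

lemma real_smul_outer_posSemidef {p : ℝ} (hp : 0 ≤ p) (f : ι → ℂ) :
    ((p : ℂ) • outer f).PosSemidef :=
  (outer_posSemidef f).smul (by exact_mod_cast hp)

/-- A Hermitian form whose values are nonnegative reals is positive semidefinite. -/
lemma posSemidef_of_quad_eq {M : Matrix ι ι ℂ} (hM : M.IsHermitian) (g : (ι → ℂ) → ℝ)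
    (h : ∀ z, star z ⬝ᵥ (M *ᵥ z) = (g z : ℂ)) (hg : ∀ z, 0 ≤ g z) : M.PosSemidef :=
  PosSemidef.of_dotProduct_mulVec_nonneg hM fun z => by
    rw [h]; exact_mod_cast hg z

lemma quad_eq_of_mulVec_eq {R : Matrix ι ι ℂ} (hR : R.IsHermitian) {x y : ι → ℂ}
    (h : R *ᵥ x = R *ᵥ y) : star x ⬝ᵥ (R *ᵥ x) = star y ⬝ᵥ (R *ᵥ y) := by
  have e (a b : ι → ℂ) : star a ⬝ᵥ (R *ᵥ b) = star (R *ᵥ a) ⬝ᵥ b := by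
    rw [star_mulVec, hR.eq, dotProduct_mulVec]
  rw [h, e, h, ← e]

/-- The product vector `w ⊗ t`. -/
def tens (w : Fin 2 → ℂ) (t : Fin 2 × Fin 2 → ℂ) : Fin 2 × Fin 2 × Fin 2 → ℂ :=
  fun x => w x.1 * t x.2

lemma quad_tens (R : Matrix (Fin 2 × Fin 2 × Fin 2) (Fin 2 × Fin 2 × Fin 2) ℂ)
    (w : Fin 2 → ℂ) (t : Fin 2 × Fin 2 → ℂ) :
    star (tens w t) ⬝ᵥ (R *ᵥ tens w t) = star t ⬝ᵥ (sand w R *ᵥ t) := by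
  simp only [dotProduct, mulVec, tens, sand, Fintype.sum_prod_type, Fin.sum_univ_two, of_apply,
    Pi.star_apply, star_mul', starRingEnd_apply]
  ring

lemma trace_mul_outer_kronecker
    (R : Matrix (Fin 2 × Fin 2 × Fin 2) (Fin 2 × Fin 2 × Fin 2) ℂ)
    (w : Fin 2 → ℂ) (t : Fin 2 × Fin 2 → ℂ) :
    (R * (outer w ⊗ₖ outer t)).trace = star t ⬝ᵥ (sand w R *ᵥ t) := by
  have h : outer w ⊗ₖ outer t = outer (tens w t) := by
    ext x y
    simp [outer, tens, vecMulVec_apply]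
    ring
  rw [h, outer, mul_vecMulVec, trace_vecMulVec, dotProduct_comm, quad_tens]

/-- The vector `Z ⊗ e_k`. -/
def appendKet (Z : Fin 2 × Fin 2 → ℂ) (k : Fin 2) : Fin 2 × Fin 2 × Fin 2 → ℂ :=
  fun x => if x.2.2 = k then Z (x.1, x.2.1) else 0

lemma quad_ptr2 (R : Matrix (Fin 2 × Fin 2 × Fin 2) (Fin 2 × Fin 2 × Fin 2) ℂ)
    (Z : Fin 2 × Fin 2 → ℂ) :
    star Z ⬝ᵥ (ptr2 R *ᵥ Z) =
      ∑ k, star (appendKet Z k) ⬝ᵥ (R *ᵥ appendKet Z k) := by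
  simp only [dotProduct, mulVec, appendKet, ptr2, Fintype.sum_prod_type, Fin.sum_univ_two,
    of_apply, Pi.star_apply]
  simp
  ring

lemma sand_outer (w : Fin 2 → ℂ) (f : Fin 2 × Fin 2 × Fin 2 → ℂ) :
    sand w (outer f) = outer fun x => ∑ a, (starRingEnd ℂ) (w a) * f (a, x) := by
  ext x y
  simp only [sand, outer, vecMulVec_apply, of_apply, Fin.sum_univ_two, Pi.star_apply, star_add,
    star_mul', starRingEnd_apply, star_star]
  ring

lemma sand_add_smul (w : Fin 2 → ℂ) (a b : ℂ)
    (R S : Matrix (Fin 2 × Fin 2 × Fin 2) (Fin 2 × Fin 2 × Fin 2) ℂ) :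
    sand w (a • R + b • S) = a • sand w R + b • sand w S := by
  ext x y
  simp only [sand, of_apply, Fin.sum_univ_two, Matrix.add_apply, Matrix.smul_apply, smul_eq_mul]
  ring

lemma exp_I_mul (t : ℝ) : Complex.exp (I * t) = (Real.cos t : ℂ) + Real.sin t * I := by
  rw [mul_comm, exp_mul_I, ofReal_cos, ofReal_sin]

lemma exp_neg_I_mul (t : ℝ) : Complex.exp (-(I * t)) = (Real.cos t : ℂ) - Real.sin t * I := by
  have := exp_I_mul (-t)
  simpa [sub_eq_add_neg] using this

lemma psiStar_zero (n : ℕ) (α : ℝ) : psiStar n α 0 = ((Real.sqrt 2 : ℂ))⁻¹ •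
    ![(Real.cos (n * α) : ℂ) - Real.sin (n * α) * I,
      (Real.cos (n * α) : ℂ) + Real.sin (n * α) * I] := by
  rw [← exp_I_mul, ← exp_neg_I_mul]
  simp [psiStar, mul_assoc]

lemma psiStar_one (n : ℕ) (α : ℝ) : psiStar n α 1 = ((Real.sqrt 2 : ℂ))⁻¹ •
    ![(Real.cos (n * α) : ℂ) + Real.sin (n * α) * I,
      (Real.cos (n * α) : ℂ) - Real.sin (n * α) * I] := by
  rw [← exp_I_mul, ← exp_neg_I_mul]
  simp [psiStar, mul_assoc]

lemma Ui_zero (α : ℝ) : Ui α 0 = fun x =>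
    if x = (0, 0) then (Real.cos α : ℂ) + Real.sin α * I
    else if x = (1, 1) then (Real.cos α : ℂ) - Real.sin α * I else 0 := by
  rw [← exp_I_mul, ← exp_neg_I_mul]
  rfl

lemma Ui_one (α : ℝ) : Ui α 1 = fun x =>
    if x = (0, 0) then (Real.cos α : ℂ) - Real.sin α * I
    else if x = (1, 1) then (Real.cos α : ℂ) + Real.sin α * I else 0 := by
  rw [← exp_I_mul, ← exp_neg_I_mul]
  funext x
  simp [Ui, Uket]

lemma ofReal_cos_sq_add_sin_sq (t : ℝ) :
    (Real.cos t : ℂ) ^ 2 + (Real.sin t : ℂ) ^ 2 = 1 := by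
  exact_mod_cast Real.cos_sq_add_sin_sq t

lemma star_Ui_dotProduct_self (α : ℝ) (i : Fin 2) : star (Ui α i) ⬝ᵥ Ui α i = 2 := by
  have h := ofReal_cos_sq_add_sin_sq α
  fin_cases i
  · simp [Ui_zero, dotProduct, Fintype.sum_prod_type, -ofReal_cos, -ofReal_sin]
    linear_combination 2 * h - 2 * (Real.sin α : ℂ) ^ 2 * I_sq
  · simp [Ui_one, dotProduct, Fintype.sum_prod_type, -ofReal_cos, -ofReal_sin]
    linear_combination 2 * h - 2 * (Real.sin α : ℂ) ^ 2 * I_sq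

/-- Nonnegative weights `p, q` such that `m₀² p + m₁² q ≤ ‖m₀ u + m₁ v‖²` for all real `m₀, m₁`;
both optimization problems have the attainable values `p + q`. -/
def Feasible (n : ℕ) (α p q : ℝ) : Prop :=
  0 ≤ p ∧ 0 ≤ q ∧ ∀ m₀ m₁ : ℝ, m₀ ^ 2 * p + m₁ ^ 2 * q ≤
    Real.cos (n * α) ^ 2 * (m₀ * Real.cos α + m₁ * Real.sin α) ^ 2 +
      Real.sin (n * α) ^ 2 * (m₀ * Real.sin α - m₁ * Real.cos α) ^ 2

lemma feasible_of_discrimination {n : ℕ} {α : ℝ} {A B : Matrix (Fin 2) (Fin 2) ℂ}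
    (hA : A.PosSemidef) (hB : B.PosSemidef) (hAB : (1 - A - B).PosSemidef)
    (hAv : brk (vvec n α) A = 0) (hBu : brk (uvec n α) B = 0) :
    Feasible n α (brk (uvec n α) A).re (brk (vvec n α) B).re := by
  refine ⟨hA.re_dotProduct_nonneg _, hB.re_dotProduct_nonneg _, fun m₀ m₁ => ?_⟩
  have hAv' : A *ᵥ vvec n α = 0 := (hA.dotProduct_mulVec_zero_iff _).1 hAv
  have hBu' : B *ᵥ uvec n α = 0 := (hB.dotProduct_mulVec_zero_iff _).1 hBu
  have hvA : star (vvec n α) ᵥ* A = 0 := by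
    rw [← hA.1.eq, ← star_mulVec, hAv', star_zero]
  have huB : star (uvec n α) ᵥ* B = 0 := by
    rw [← hB.1.eq, ← star_mulVec, hBu', star_zero]
  have h := hAB.re_dotProduct_nonneg ((m₀ : ℂ) • uvec n α + (m₁ : ℂ) • vvec n α)
  have e : star ((m₀ : ℂ) • uvec n α + (m₁ : ℂ) • vvec n α) ⬝ᵥ
      ((1 - A - B) *ᵥ ((m₀ : ℂ) • uvec n α + (m₁ : ℂ) • vvec n α)) =
      ((Real.cos (n * α) ^ 2 * (m₀ * Real.cos α + m₁ * Real.sin α) ^ 2 +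
      Real.sin (n * α) ^ 2 * (m₀ * Real.sin α - m₁ * Real.cos α) ^ 2 : ℝ) : ℂ) -
      ((m₀ ^ 2 : ℝ) * brk (uvec n α) A + (m₁ ^ 2 : ℝ) * brk (vvec n α) B) := by
    have hn : star ((m₀ : ℂ) • uvec n α + (m₁ : ℂ) • vvec n α) ⬝ᵥ
        ((m₀ : ℂ) • uvec n α + (m₁ : ℂ) • vvec n α) =
        ((Real.cos (n * α) ^ 2 * (m₀ * Real.cos α + m₁ * Real.sin α) ^ 2 +
        Real.sin (n * α) ^ 2 * (m₀ * Real.sin α - m₁ * Real.cos α) ^ 2 : ℝ) : ℂ) := by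
      rw [star_dotProduct_self_eq_sum_normSq]
      congr 1
      simp [uvec, vvec, Fin.sum_univ_two, normSq_apply, -ofReal_cos, -ofReal_sin,
        -ofReal_mul]
      ring
    rw [sub_mulVec, sub_mulVec, one_mulVec, dotProduct_sub, dotProduct_sub, hn, sub_sub]
    congr 2
    · rw [mulVec_add, mulVec_smul, mulVec_smul, hAv', star_add, add_dotProduct, star_smul,
        star_smul, smul_dotProduct, smul_dotProduct, smul_zero, add_zero, dotProduct_smul,
        dotProduct_smul, dotProduct_mulVec (star (vvec n α)), hvA, zero_dotProduct]
      simp [brk]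
      ring
    · rw [mulVec_add, mulVec_smul, mulVec_smul, hBu', star_add, add_dotProduct, star_smul,
        star_smul, smul_dotProduct, smul_dotProduct, smul_zero, zero_add, dotProduct_smul,
        dotProduct_smul, dotProduct_mulVec (star (uvec n α)), huB, zero_dotProduct]
      simp [brk]
      ring
  rw [e] at h
  simp only [map_sub, map_add, RCLike.re_to_complex, re_ofReal_mul, ofReal_re] at h
  linarith

/-- A quadratic form bound for real vectors extends to complex vectors. -/
lemma quad_bound_complex {κ : Type*} [Fintype κ] {p q : ℝ} (f h : κ → ι → ℝ)
    (hb : ∀ z : ι → ℝ, p * ∑ k, (f k ⬝ᵥ z) ^ 2 + q * ∑ k, (h k ⬝ᵥ z) ^ 2 ≤ ∑ i, z i ^ 2)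
    (z : ι → ℂ) :
    0 ≤ ∑ i, normSq (z i) -
      (p * ∑ k, normSq (star (fun i => (f k i : ℂ)) ⬝ᵥ z) +
        q * ∑ k, normSq (star (fun i => (h k i : ℂ)) ⬝ᵥ z)) := by
  have e (g : ι → ℝ) : normSq (star (fun i => (g i : ℂ)) ⬝ᵥ z) =
      (g ⬝ᵥ fun i => (z i).re) ^ 2 + (g ⬝ᵥ fun i => (z i).im) ^ 2 := by
    simp [normSq_apply, dotProduct, sq]
  have h1 := hb fun i => (z i).re
  have h2 := hb fun i => (z i).im
  simp only [e, Finset.sum_add_distrib]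
  have e2 : ∑ i, normSq (z i) = ∑ i, (z i).re ^ 2 + ∑ i, (z i).im ^ 2 := by
    rw [← Finset.sum_add_distrib]
    exact Finset.sum_congr rfl fun i _ => by rw [normSq_apply]; ring
  rw [e2]
  linarith

/-- The identity dominates a combination of rank-one projections given by real vectors as soon as
it does so on real vectors. -/
lemma one_sub_outer_posSemidef [DecidableEq ι] {κ : Type*} [Fintype κ] {p q : ℝ}
    (f h : κ → ι → ℝ)
    (hb : ∀ z : ι → ℝ, p * ∑ k, (f k ⬝ᵥ z) ^ 2 + q * ∑ k, (h k ⬝ᵥ z) ^ 2 ≤ ∑ i, z i ^ 2) :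
    (1 - ((p : ℂ) • ∑ k, outer (fun i => (f k i : ℂ)) +
      (q : ℂ) • ∑ k, outer (fun i => (h k i : ℂ)))).PosSemidef := by
  have hs (g : κ → ι → ℝ) : (∑ k, outer (fun i => (g k i : ℂ))).PosSemidef :=
    posSemidef_sum _ fun k _ => outer_posSemidef _
  have hr (r : ℝ) : IsSelfAdjoint (r : ℂ) := conj_ofReal r
  refine posSemidef_of_quad_eq (isHermitian_one.sub
    (((hs f).1.smul (hr p)).add ((hs h).1.smul (hr q)))) _ (fun z => ?_)
    (quad_bound_complex f h hb)
  simp only [sub_mulVec, add_mulVec, smul_mulVec, one_mulVec, sum_mulVec, dotProduct_sub,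
    dotProduct_add, dotProduct_smul, dotProduct_sum, quad_outer,
    star_dotProduct_self_eq_sum_normSq]
  push_cast
  rfl

lemma discrimination_of_feasible {n : ℕ} {α p q : ℝ} (hc : Real.cos (n * α) ≠ 0)
    (hs : Real.sin (n * α) ≠ 0) (hpq : Feasible n α p q) :
    ∃ A B : Matrix (Fin 2) (Fin 2) ℂ,
      A.PosSemidef ∧ B.PosSemidef ∧ (1 - A - B).PosSemidef ∧
      brk (vvec n α) A = 0 ∧ brk (uvec n α) B = 0 ∧
      p + q = (brk (uvec n α) A + brk (vvec n α) B).re := by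
  obtain ⟨hp, hq, hpq⟩ := hpq
  have h1 := Real.cos_sq_add_sin_sq α
  let f : Fin 2 → ℝ := ![Real.cos α / Real.cos (n * α), Real.sin α / Real.sin (n * α)]
  let h : Fin 2 → ℝ := ![Real.sin α / Real.cos (n * α), -(Real.cos α / Real.sin (n * α))]
  have hd (w g : Fin 2 → ℝ) (r : ℝ) :
      brk (fun i => (w i : ℂ)) ((r : ℂ) • outer fun i => (g i : ℂ)) =
      ((r * (g 0 * w 0 + g 1 * w 1) ^ 2 : ℝ) : ℂ) := by
    rw [brk, smul_mulVec, dotProduct_smul, quad_outer, smul_eq_mul, ← ofReal_mul]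
    congr 2
    simp [dotProduct, Fin.sum_univ_two, normSq_apply]
    ring
  have hu : uvec n α = fun i =>
      ((![Real.cos (n * α) * Real.cos α, Real.sin (n * α) * Real.sin α] i : ℝ) : ℂ) := by
    funext i; fin_cases i <;> rfl
  have hv : vvec n α = fun i =>
      ((![Real.cos (n * α) * Real.sin α, -(Real.sin (n * α) * Real.cos α)] i : ℝ) : ℂ) := by
    funext i; fin_cases i <;> rfl
  refine ⟨(p : ℂ) • outer fun i => (f i : ℂ), (q : ℂ) • outer fun i => (h i : ℂ),
    real_smul_outer_posSemidef hp _, real_smul_outer_posSemidef hq _, ?_, ?_, ?_, ?_⟩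
  · have := one_sub_outer_posSemidef (p := p) (q := q) (fun _ : Fin 1 => f) (fun _ => h) ?_
    · simpa [sub_sub] using this
    · intro z
      have := hpq (f ⬝ᵥ z) (h ⬝ᵥ z)
      have e1 : Real.cos (n * α) * (f ⬝ᵥ z * Real.cos α + h ⬝ᵥ z * Real.sin α) = z 0 := by
        simp only [f, h, dotProduct, Fin.sum_univ_two, cons_val_zero, cons_val_one]
        field_simp
        linear_combination Real.sin (n * α) * z 0 * h1
      have e2 : Real.sin (n * α) * (f ⬝ᵥ z * Real.sin α - h ⬝ᵥ z * Real.cos α) = z 1 := by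
        simp only [f, h, dotProduct, Fin.sum_univ_two, cons_val_zero, cons_val_one]
        field_simp
        linear_combination Real.cos (n * α) * z 1 * h1
      rw [← mul_pow, ← mul_pow, e1, e2] at this
      simpa [Fin.sum_univ_two, mul_comm] using this
  · rw [hv, hd]
    simp only [f, cons_val_zero, cons_val_one]
    norm_cast
    field_simp
    ring
  · rw [hu, hd]
    simp only [h, cons_val_zero, cons_val_one]
    norm_cast
    field_simp
    ring
  · rw [hu, hv, hd, hd, ← ofReal_add, ofReal_re]
    simp only [f, h, cons_val_zero, cons_val_one]
    field_simp
    have h2 : Real.sin α ^ 2 + Real.cos α ^ 2 = 1 := by linarith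
    simp only [h1, h2]
    ring

lemma trace_mul_Dop {n : ℕ} {α : ℝ}
    {R : Matrix (Fin 2 × Fin 2 × Fin 2) (Fin 2 × Fin 2 × Fin 2) ℂ} {lam : Fin 2 → ℝ}
    (h : ∀ i, sand (psiStar n α i) R = (lam i : ℂ) • outer (Ui α i)) :
    ((R * Dop n α).trace).re = (lam 0 + lam 1) / 2 := by
  have e (i : Fin 2) : (R * (outer (psiStar n α i) ⊗ₖ outer (Ui α i))).trace = 4 * lam i := by
    rw [trace_mul_outer_kronecker, h, smul_mulVec, dotProduct_smul, quad_outer,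
      star_Ui_dotProduct_self]
    simp
    ring
  rw [Dop, Matrix.mul_smul, Matrix.mul_sum, trace_smul, trace_sum, Fin.sum_univ_two, e, e]
  have : (1 / 8 : ℂ) • (4 * (lam 0 : ℂ) + 4 * lam 1) = (((lam 0 + lam 1) / 2 : ℝ) : ℂ) := by
    push_cast
    simp only [smul_eq_mul]
    ring
  rw [this, ofReal_re]

lemma mulVec_tens {R : Matrix (Fin 2 × Fin 2 × Fin 2) (Fin 2 × Fin 2 × Fin 2) ℂ}
    (hR : R.PosSemidef) {w : Fin 2 → ℂ} {U : Fin 2 × Fin 2 → ℂ} {lam : ℂ}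
    (h : sand w R = lam • outer U) (hU : star U ⬝ᵥ U = 2) (t : Fin 2 × Fin 2 → ℂ) :
    R *ᵥ tens w t = (star U ⬝ᵥ t / 2) • (R *ᵥ tens w U) := by
  have h0 : star U ⬝ᵥ (t - (star U ⬝ᵥ t / 2) • U) = 0 := by
    rw [dotProduct_sub, dotProduct_smul, hU, smul_eq_mul]
    ring
  have hz : R *ᵥ tens w (t - (star U ⬝ᵥ t / 2) • U) = 0 := by
    rw [← hR.dotProduct_mulVec_zero_iff, quad_tens, h, smul_mulVec, dotProduct_smul, quad_outer,
      h0]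
    simp
  have e : tens w (t - (star U ⬝ᵥ t / 2) • U) =
      tens w t - (star U ⬝ᵥ t / 2) • tens w U := by
    funext x
    simp [tens]
    ring
  rwa [e, mulVec_sub, mulVec_smul, sub_eq_zero] at hz

/-- The test vector `∑ᵢ dᵢ Uᵢ(b,b) ψ*ᵢ ⊗ e_b`, with `d` depending on `b`. -/
def testVec (n : ℕ) (α : ℝ) (d : Fin 2 → Fin 2 → ℂ) : Fin 2 × Fin 2 → ℂ :=
  fun x => ∑ i, d i x.2 * Ui α i (x.2, x.2) * psiStar n α i x.1

lemma quad_appendKet_testVec {n : ℕ} {α : ℝ}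
    {R : Matrix (Fin 2 × Fin 2 × Fin 2) (Fin 2 × Fin 2 × Fin 2) ℂ} (hR : R.PosSemidef)
    {lam : Fin 2 → ℂ} (h : ∀ i, sand (psiStar n α i) R = lam i • outer (Ui α i))
    (d : Fin 2 → Fin 2 → ℂ) (k : Fin 2) :
    4 * (star (appendKet (testVec n α d) k) ⬝ᵥ (R *ᵥ appendKet (testVec n α d) k)) =
      star (∑ i, d i k • tens (psiStar n α i) (Ui α i)) ⬝ᵥ
        (R *ᵥ ∑ i, d i k • tens (psiStar n α i) (Ui α i)) := by
  have e : appendKet (testVec n α d) k = ∑ i, tens (psiStar n α i)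
      (fun x => if x.2 = k then d i x.1 * Ui α i (x.1, x.1) else 0) := by
    funext x
    simp only [appendKet, testVec, tens, Finset.sum_apply]
    split_ifs
    · exact Finset.sum_congr rfl fun i _ => by ring
    · simp
  have hU (i : Fin 2) : star (Ui α i) ⬝ᵥ
      (fun x => if x.2 = k then d i x.1 * Ui α i (x.1, x.1) else 0) = d i k := by
    have h := ofReal_cos_sq_add_sin_sq α
    fin_cases i <;> fin_cases k <;>
    · simp [Ui_zero, Ui_one, dotProduct, Fintype.sum_prod_type, -ofReal_cos, -ofReal_sin]
      linear_combination d _ _ * h - d _ _ * (Real.sin α : ℂ) ^ 2 * I_sq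
  have hm : R *ᵥ appendKet (testVec n α d) k =
      R *ᵥ ((1 / 2 : ℂ) • ∑ i, d i k • tens (psiStar n α i) (Ui α i)) := by
    rw [e, mulVec_sum, mulVec_smul, mulVec_sum, Finset.smul_sum]
    refine Finset.sum_congr rfl fun i _ => ?_
    rw [mulVec_tens hR (h i) (star_Ui_dotProduct_self α i), hU, mulVec_smul, smul_smul]
    congr 1
    ring
  rw [quad_eq_of_mulVec_eq hR.1 hm, star_smul, smul_dotProduct, mulVec_smul, dotProduct_smul]
  simp
  ring

lemma sum_normSq_testVec (n : ℕ) (α m₀ m₁ : ℝ) :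
    ∑ x, normSq (testVec n α ![![m₀ - m₁ * I, m₀ + m₁ * I], ![m₀ + m₁ * I, m₀ - m₁ * I]] x) =
      8 * (Real.cos (n * α) ^ 2 * (m₀ * Real.cos α + m₁ * Real.sin α) ^ 2 +
        Real.sin (n * α) ^ 2 * (m₀ * Real.sin α - m₁ * Real.cos α) ^ 2) := by
  have h2 : ((Real.sqrt 2)⁻¹) ^ 2 = 1 / 2 := by
    rw [inv_pow, Real.sq_sqrt (by norm_num)]; norm_num
  simp only [testVec, psiStar_zero, psiStar_one, Ui_zero, Ui_one, Fintype.sum_prod_type,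
    Fin.sum_univ_two, ← ofReal_inv]
  simp [normSq_apply, -ofReal_cos, -ofReal_sin, -ofReal_inv]
  ring_nf
  rw [h2]
  ring

lemma feasible_of_retrieval {n : ℕ} {α : ℝ}
    {R : Matrix (Fin 2 × Fin 2 × Fin 2) (Fin 2 × Fin 2 × Fin 2) ℂ} (hR : R.PosSemidef)
    (hR1 : (1 - ptr2 R).PosSemidef) (hP : PerfectRetrieval n α R) :
    ∃ p q : ℝ, Feasible n α p q ∧ ((R * Dop n α).trace).re = p + q := by
  obtain ⟨l0, l1, -, -, h0, h1⟩ := hP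
  have hl : ∀ i, sand (psiStar n α i) R = ((![l0, l1] i : ℝ) : ℂ) • outer (Ui α i) := by
    intro i
    fin_cases i
    exacts [h0, h1]
  let ξ (i : Fin 2) := tens (psiStar n α i) (Ui α i)
  let Q (x y : Fin 2 × Fin 2 × Fin 2 → ℂ) : ℂ := star x ⬝ᵥ (R *ᵥ y)
  have hQ (a b : ℂ) : Q (a • ξ 0 + b • ξ 1) (a • ξ 0 + b • ξ 1) =
      star a * a * Q (ξ 0) (ξ 0) + star a * b * Q (ξ 0) (ξ 1) +
      star b * a * Q (ξ 1) (ξ 0) + star b * b * Q (ξ 1) (ξ 1) := by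
    simp only [Q, star_add, star_smul, add_dotProduct, smul_dotProduct, mulVec_add, mulVec_smul,
      dotProduct_add, dotProduct_smul, smul_eq_mul]
    ring
  have hdiag (i : Fin 2) : Q (ξ i) (ξ i) = 4 * (![l0, l1] i : ℝ) := by
    simp only [Q, ξ]
    rw [quad_tens, hl, smul_mulVec, dotProduct_smul, quad_outer, star_Ui_dotProduct_self]
    simp
    ring
  refine ⟨(Q ((1 : ℂ) • ξ 0 + (1 : ℂ) • ξ 1) ((1 : ℂ) • ξ 0 + (1 : ℂ) • ξ 1)).re / 16,
    (Q ((1 : ℂ) • ξ 0 + (-1 : ℂ) • ξ 1) ((1 : ℂ) • ξ 0 + (-1 : ℂ) • ξ 1)).re / 16,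
    ⟨div_nonneg (hR.re_dotProduct_nonneg _) (by norm_num),
      div_nonneg (hR.re_dotProduct_nonneg _) (by norm_num), fun m₀ m₁ => ?_⟩, ?_⟩
  · have h := hR1.re_dotProduct_nonneg
      (testVec n α ![![m₀ - m₁ * I, m₀ + m₁ * I], ![m₀ + m₁ * I, m₀ - m₁ * I]])
    have ek (k : Fin 2) := quad_appendKet_testVec hR hl
      ![![m₀ - m₁ * I, m₀ + m₁ * I], ![m₀ + m₁ * I, m₀ - m₁ * I]] k
    have e0 := congrArg re (ek 0)
    have e1 := congrArg re (ek 1)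
    simp only [Fin.sum_univ_two, cons_val_zero, cons_val_one] at e0 e1
    change _ = (Q (_ • ξ 0 + _ • ξ 1) (_ • ξ 0 + _ • ξ 1)).re at e0 e1
    rw [hQ] at e0 e1
    rw [sub_mulVec, one_mulVec, dotProduct_sub, star_dotProduct_self_eq_sum_normSq,
      sum_normSq_testVec, quad_ptr2, Fin.sum_univ_two] at h
    rw [hQ, hQ]
    simp only [map_sub, map_add, RCLike.re_to_complex, ofReal_re] at h
    simp at e0 e1 ⊢
    linarith
  · rw [trace_mul_Dop hl, hQ, hQ, hdiag, hdiag]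
    simp
    ring

/-- The three-qubit vector assembled from the slices `f k` over the last factor. -/
def ofSlices (f : Fin 2 → Fin 2 × Fin 2 → ℝ) : Fin 2 × Fin 2 × Fin 2 → ℂ :=
  fun x => (f x.2.2 (x.1, x.2.1) : ℂ)

lemma ptr2_add_smul_outer_ofSlices (f h : Fin 2 → Fin 2 × Fin 2 → ℝ) (p q : ℂ) :
    ptr2 (p • outer (ofSlices f) + q • outer (ofSlices h)) =
      p • ∑ k, outer (fun x => (f k x : ℂ)) + q • ∑ k, outer (fun x => (h k x : ℂ)) := by
  ext x y
  simp only [ptr2, outer, ofSlices, vecMulVec_apply, of_apply, Fin.sum_univ_two,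
    Matrix.add_apply, Matrix.smul_apply, smul_eq_mul, Pi.star_apply]
  ring

lemma outer_smul (c : ℂ) (hc : star c * c = 1) (f : ι → ℂ) : outer (c • f) = outer f := by
  ext x y
  simp only [outer, vecMulVec_apply, Pi.smul_apply, Pi.star_apply, smul_eq_mul, star_mul']
  linear_combination f x * star (f y) * hc

/-- The slices `g k a ⊗ e_k`, rescaled. -/
def diagSlices (κ : ℝ) (g : Fin 2 → Fin 2 → ℝ) : Fin 2 → Fin 2 × Fin 2 → ℝ :=
  fun k x => if x.2 = k then κ * g k x.1 else 0

lemma retrieval_of_feasible {n : ℕ} {α p q : ℝ} (hc : Real.cos (n * α) ≠ 0)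
    (hs : Real.sin (n * α) ≠ 0) (hpq : Feasible n α p q) :
    ∃ R : Matrix (Fin 2 × Fin 2 × Fin 2) (Fin 2 × Fin 2 × Fin 2) ℂ,
      R.PosSemidef ∧ (1 - ptr2 R).PosSemidef ∧ PerfectRetrieval n α R ∧
      p + q = ((R * Dop n α).trace).re := by
  obtain ⟨hp, hq, hpq⟩ := hpq
  obtain ⟨r, hr⟩ : ∃ r, r = Real.sqrt 2 := ⟨_, rfl⟩
  have hr2 : r ^ 2 = 2 := by rw [hr, Real.sq_sqrt (by norm_num)]
  have hr0 : r ≠ 0 := by rintro rfl; norm_num at hr2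
  obtain ⟨x, hx⟩ : ∃ x, x = Real.cos (n * α) := ⟨_, rfl⟩
  obtain ⟨y, hy⟩ : ∃ y, y = Real.sin (n * α) := ⟨_, rfl⟩
  obtain ⟨c, hcα⟩ : ∃ c, c = Real.cos α := ⟨_, rfl⟩
  obtain ⟨s, hsα⟩ : ∃ s, s = Real.sin α := ⟨_, rfl⟩
  have hcs : c ^ 2 + s ^ 2 = 1 := by rw [hcα, hsα, Real.cos_sq_add_sin_sq]
  rw [← hx] at hc
  rw [← hy] at hs
  simp only [← hx, ← hy, ← hcα, ← hsα] at hpq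
  let κ := r / (2 * y * x)
  let f := diagSlices κ ![![y * c + x * s, y * c - x * s], ![y * c - x * s, y * c + x * s]]
  let h := diagSlices κ ![![x * c - y * s, -(x * c) - y * s], ![x * c + y * s, -(x * c) + y * s]]
  have hψ0 : psiStar n α 0 = (r : ℂ)⁻¹ • ![(x : ℂ) - y * I, (x : ℂ) + y * I] := by
    rw [hr, hx, hy, psiStar_zero]
  have hψ1 : psiStar n α 1 = (r : ℂ)⁻¹ • ![(x : ℂ) + y * I, (x : ℂ) - y * I] := by
    rw [hr, hx, hy, psiStar_one]
  have hU0 : Ui α 0 = fun x => if x = (0, 0) then (c : ℂ) + s * I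
      else if x = (1, 1) then (c : ℂ) - s * I else 0 := by
    rw [hcα, hsα, Ui_zero]
  have hU1 : Ui α 1 = fun x => if x = (0, 0) then (c : ℂ) - s * I
      else if x = (1, 1) then (c : ℂ) + s * I else 0 := by
    rw [hcα, hsα, Ui_one]
  have hxC : (x : ℂ) ≠ 0 := by exact_mod_cast hc
  have hyC : (y : ℂ) ≠ 0 := by exact_mod_cast hs
  have hrC : (r : ℂ) ≠ 0 := by exact_mod_cast hr0
  have hf0 : (fun z => ∑ a, (starRingEnd ℂ) (psiStar n α 0 a) * ofSlices f (a, z)) = Ui α 0 := by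
    funext ⟨i, j⟩
    fin_cases i <;> fin_cases j <;>
      simp [hψ0, hU0, Fin.sum_univ_two, ofSlices, f, diagSlices, κ] <;> field_simp <;> ring
  have hf1 : (fun z => ∑ a, (starRingEnd ℂ) (psiStar n α 1 a) * ofSlices f (a, z)) = Ui α 1 := by
    funext ⟨i, j⟩
    fin_cases i <;> fin_cases j <;>
      simp [hψ1, hU1, Fin.sum_univ_two, ofSlices, f, diagSlices, κ] <;> field_simp <;> ring
  have hh0 : (fun z => ∑ a, (starRingEnd ℂ) (psiStar n α 0 a) * ofSlices h (a, z)) =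
      I • Ui α 0 := by
    funext ⟨i, j⟩
    fin_cases i <;> fin_cases j <;>
      simp [hψ0, hU0, Fin.sum_univ_two, ofSlices, h, diagSlices, κ] <;> field_simp <;>
      ring_nf <;> simp [sub_eq_add_neg]
  have hh1 : (fun z => ∑ a, (starRingEnd ℂ) (psiStar n α 1 a) * ofSlices h (a, z)) =
      (-I) • Ui α 1 := by
    funext ⟨i, j⟩
    fin_cases i <;> fin_cases j <;>
      simp [hψ1, hU1, Fin.sum_univ_two, ofSlices, h, diagSlices, κ] <;> field_simp <;>
      ring_nf <;> simp [sub_eq_add_neg]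
  let R := (p : ℂ) • outer (ofSlices f) + (q : ℂ) • outer (ofSlices h)
  have h0 : sand (psiStar n α 0) R = ((p + q : ℝ) : ℂ) • outer (Ui α 0) := by
    rw [sand_add_smul, sand_outer, sand_outer, hf0, hh0, outer_smul _ (by simp), ← add_smul,
      ofReal_add]
  have h1 : sand (psiStar n α 1) R = ((p + q : ℝ) : ℂ) • outer (Ui α 1) := by
    rw [sand_add_smul, sand_outer, sand_outer, hf1, hh1, outer_smul _ (by simp), ← add_smul,
      ofReal_add]
  refine ⟨R, (real_smul_outer_posSemidef hp _).add (real_smul_outer_posSemidef hq _), ?_,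
    ⟨p + q, p + q, add_nonneg hp hq, add_nonneg hp hq, h0, h1⟩, ?_⟩
  · rw [ptr2_add_smul_outer_ofSlices]
    refine one_sub_outer_posSemidef f h fun z => ?_
    have b0 := hpq (f 0 ⬝ᵥ z) (-(h 0 ⬝ᵥ z))
    have b1 := hpq (f 1 ⬝ᵥ z) (h 1 ⬝ᵥ z)
    have e1 : f 0 ⬝ᵥ z * c + -(h 0 ⬝ᵥ z) * s = r / (2 * x) * (z (0, 0) + z (1, 0)) := by
      simp [f, h, diagSlices, dotProduct, Fintype.sum_prod_type, κ]
      field_simp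
      linear_combination y * (z (0, 0) + z (1, 0)) * hcs
    have e2 : f 0 ⬝ᵥ z * s - -(h 0 ⬝ᵥ z) * c = r / (2 * y) * (z (0, 0) - z (1, 0)) := by
      simp [f, h, diagSlices, dotProduct, Fintype.sum_prod_type, κ]
      field_simp
      linear_combination x * (z (0, 0) - z (1, 0)) * hcs
    have e3 : f 1 ⬝ᵥ z * c + h 1 ⬝ᵥ z * s = r / (2 * x) * (z (0, 1) + z (1, 1)) := by
      simp [f, h, diagSlices, dotProduct, Fintype.sum_prod_type, κ]
      field_simp
      linear_combination y * (z (0, 1) + z (1, 1)) * hcs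
    have e4 : f 1 ⬝ᵥ z * s - h 1 ⬝ᵥ z * c = r / (2 * y) * (z (1, 1) - z (0, 1)) := by
      simp [f, h, diagSlices, dotProduct, Fintype.sum_prod_type, κ]
      field_simp
      linear_combination x * (z (1, 1) - z (0, 1)) * hcs
    have hn (a b : ℝ) : x ^ 2 * (r / (2 * x) * a) ^ 2 + y ^ 2 * (r / (2 * y) * b) ^ 2 =
        (a ^ 2 + b ^ 2) / 2 := by
      field_simp
      rw [hr2]
    rw [e1, e2, hn] at b0
    rw [e3, e4, hn] at b1
    simp only [Fin.sum_univ_two, Fintype.sum_prod_type]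
    linarith
  · rw [trace_mul_Dop (lam := fun _ => p + q) (fun i => by fin_cases i; exacts [h0, h1])]
    ring

end

theorem probabilistic_retrieval_as_unambiguous_discrimination (n : ℕ) (hn : 1 ≤ n) (α : ℝ)
    (hα : 0 < α) (hdist : 4 * n * α < Real.pi) :
    sSup {x : ℝ | ∃ R : Matrix (Fin 2 × Fin 2 × Fin 2) (Fin 2 × Fin 2 × Fin 2) ℂ,
        R.PosSemidef ∧ (1 - ptr2 R).PosSemidef ∧ PerfectRetrieval n α R ∧
        x = ((R * Dop n α).trace).re}
    = sSup {x : ℝ | ∃ A B : Matrix (Fin 2) (Fin 2) ℂ,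
        A.PosSemidef ∧ B.PosSemidef ∧ (1 - A - B).PosSemidef ∧
        brk (vvec n α) A = 0 ∧ brk (uvec n α) B = 0 ∧
        x = (brk (uvec n α) A + brk (vvec n α) B).re} := by
  have hn1 : (1 : ℝ) ≤ n := by exact_mod_cast hn
  have hpos : 0 < n * α := by positivity
  have hc : Real.cos (n * α) ≠ 0 :=
    (Real.cos_pos_of_mem_Ioo ⟨by linarith [Real.pi_pos], by linarith⟩).ne'
  have hs : Real.sin (n * α) ≠ 0 := (Real.sin_pos_of_pos_of_lt_pi hpos (by linarith)).ne'
  congr 1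
  ext x
  constructor
  · rintro ⟨R, hR, hR1, hP, rfl⟩
    obtain ⟨p, q, hpq, h⟩ := feasible_of_retrieval hR hR1 hP
    rw [h]
    exact discrimination_of_feasible hc hs hpq
  · rintro ⟨A, B, hA, hB, hAB, hAv, hBu, rfl⟩
    rw [add_re]
    exact retrieval_of_feasible hc hs (feasible_of_discrimination hA hB hAB hAv hBu)
end
end

section
/- Assume moreover cos(2nα)·(cos(2α) + sin(2α)) ≤ 1 (the large-α regime). Then 1 − cos(2nα)·sin(2α) is the greatest element of the set {x : ℝ | ∃ A B : Matrix (Fin 2) (Fin 2) ℂ, A PSD ∧ B PSD ∧ (I₂ − A − B) PSD ∧ ⟨v|A|v⟩ = 0 ∧ ⟨u|B|u⟩ = 0 ∧ x = Re(⟨u|A|u⟩ + ⟨v|B|v⟩)}. (The large-α branch of Eq. (23): optimal success probability of perfect probabilistic storage and retrieval of two unitaries.) -/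
open Matrix Kronecker Complex Filter
open scoped ComplexOrder

noncomputable section

lemma star_ofReal_vec (a b : ℝ) : star ![(a : ℂ), (b : ℂ)] = ![(a : ℂ), (b : ℂ)] := by
  ext i
  fin_cases i <;> simp

lemma posSemidef_smul_vecMulVec_ofReal {r : ℝ} (hr : 0 ≤ r) (a b : ℝ) :
    ((r : ℂ) • vecMulVec ![(a : ℂ), (b : ℂ)] ![(a : ℂ), (b : ℂ)]).PosSemidef := by
  have h := posSemidef_vecMulVec_self_star ![(a : ℂ), (b : ℂ)]
  rw [star_ofReal_vec] at h
  exact h.smul (by exact_mod_cast hr)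

lemma brk_add_brk_le {u v : Fin 2 → ℂ} {A B : Matrix (Fin 2) (Fin 2) ℂ}
    (hA : A.PosSemidef) (hB : B.PosSemidef) (hE : (1 - A - B).PosSemidef)
    (hv : brk v A = 0) (hu : brk u B = 0) :
    (brk u A + brk v B).re ≤ (star (u - v) ⬝ᵥ (u - v)).re := by
  have hAv : A *ᵥ v = 0 := (hA.dotProduct_mulVec_zero_iff v).1 hv
  have hBu : B *ᵥ u = 0 := (hB.dotProduct_mulVec_zero_iff u).1 hu
  have hvA : star v ᵥ* A = 0 := by
    rw [← hA.isHermitian.eq, ← star_mulVec, hAv, star_zero]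
  have huB : star u ᵥ* B = 0 := by
    rw [← hB.isHermitian.eq, ← star_mulVec, hBu, star_zero]
  have hAuv : star (u - v) ⬝ᵥ A *ᵥ (u - v) = brk u A := by
    rw [mulVec_sub, hAv, sub_zero, star_sub, sub_dotProduct, dotProduct_mulVec (star v), hvA,
      zero_dotProduct, sub_zero, brk]
  have hBuv : star (u - v) ⬝ᵥ B *ᵥ (u - v) = brk v B := by
    rw [mulVec_sub, hBu, zero_sub, star_sub, sub_dotProduct, dotProduct_neg, dotProduct_neg,
      dotProduct_mulVec (star u), huB, zero_dotProduct, neg_zero, zero_sub, neg_neg, brk]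
  have h := (Complex.le_def.1 (hE.dotProduct_mulVec_nonneg (u - v))).1
  rw [sub_mulVec, sub_mulVec, one_mulVec, dotProduct_sub, dotProduct_sub, hAuv, hBuv] at h
  simp only [Complex.zero_re, Complex.sub_re] at h
  rw [Complex.add_re]
  linarith

/-- Optimal unambiguous discrimination of two real vectors, in the regime where both vectors are
detected. -/
lemma isGreatest_unambiguous_discrimination {u₁ u₂ v₁ v₂ : ℝ} (hD : u₁ * v₂ - u₂ * v₁ ≠ 0)
    (hh : 0 ≤ u₁ * v₁ + u₂ * v₂)
    (hu : u₁ * v₁ + u₂ * v₂ ≤ u₁ ^ 2 + u₂ ^ 2)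
    (hv : u₁ * v₁ + u₂ * v₂ ≤ v₁ ^ 2 + v₂ ^ 2) :
    IsGreatest
      {x : ℝ | ∃ A B : Matrix (Fin 2) (Fin 2) ℂ,
        A.PosSemidef ∧ B.PosSemidef ∧ (1 - A - B).PosSemidef ∧
        brk ![(v₁ : ℂ), (v₂ : ℂ)] A = 0 ∧ brk ![(u₁ : ℂ), (u₂ : ℂ)] B = 0 ∧
        x = (brk ![(u₁ : ℂ), (u₂ : ℂ)] A + brk ![(v₁ : ℂ), (v₂ : ℂ)] B).re}
      ((u₁ - v₁) ^ 2 + (u₂ - v₂) ^ 2) := by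
  constructor
  · have hD2 : 0 < (u₁ * v₂ - u₂ * v₁) ^ 2 := by positivity
    have hDc : (u₁ * v₂ - u₂ * v₁ : ℂ) ≠ 0 := by exact_mod_cast hD
    have hDc' : (u₁ * v₂ - v₁ * u₂ : ℂ) ≠ 0 := by rwa [mul_comm (v₁ : ℂ)]
    refine ⟨(((u₁ ^ 2 + u₂ ^ 2 - (u₁ * v₁ + u₂ * v₂)) / (u₁ * v₂ - u₂ * v₁) ^ 2 : ℝ) : ℂ) •
        vecMulVec ![(v₂ : ℂ), ((-v₁ : ℝ) : ℂ)] ![(v₂ : ℂ), ((-v₁ : ℝ) : ℂ)],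
      (((v₁ ^ 2 + v₂ ^ 2 - (u₁ * v₁ + u₂ * v₂)) / (u₁ * v₂ - u₂ * v₁) ^ 2 : ℝ) : ℂ) •
        vecMulVec ![(u₂ : ℂ), ((-u₁ : ℝ) : ℂ)] ![(u₂ : ℂ), ((-u₁ : ℝ) : ℂ)],
      posSemidef_smul_vecMulVec_ofReal (div_nonneg (by linarith) hD2.le) _ _,
      posSemidef_smul_vecMulVec_ofReal (div_nonneg (by linarith) hD2.le) _ _, ?_, ?_, ?_, ?_⟩
    · convert posSemidef_smul_vecMulVec_ofReal (div_nonneg hh hD2.le) (u₂ - v₂) (-(u₁ - v₁))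
        using 1
      ext i j
      fin_cases i <;> fin_cases j <;> simp <;> field_simp <;> ring
    · rw [brk, star_ofReal_vec]
      simp [mulVec, dotProduct, Fin.sum_univ_two]
      ring
    · rw [brk, star_ofReal_vec]
      simp [mulVec, dotProduct, Fin.sum_univ_two]
      ring
    · rw [brk, brk, star_ofReal_vec, star_ofReal_vec, ← Complex.ofReal_re (_ + _)]
      congr 1
      simp [mulVec, dotProduct, Fin.sum_univ_two]
      field_simp
      ring
  · rintro x ⟨A, B, hA, hB, hE, hAv, hBu, rfl⟩
    refine (brk_add_brk_le hA hB hE hAv hBu).trans_eq ?_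
    simp [dotProduct, Fin.sum_univ_two]
    ring

theorem optimal_success_large_alpha (n : ℕ) (hn : 1 ≤ n) (α : ℝ) (hα : 0 < α)
    (hdist : 4 * n * α < Real.pi)
    (hreg : Real.cos (2 * n * α) * (Real.cos (2 * α) + Real.sin (2 * α)) ≤ 1) :
    IsGreatest
      {x : ℝ | ∃ A B : Matrix (Fin 2) (Fin 2) ℂ,
        A.PosSemidef ∧ B.PosSemidef ∧ (1 - A - B).PosSemidef ∧
        brk (vvec n α) A = 0 ∧ brk (uvec n α) B = 0 ∧
        x = (brk (uvec n α) A + brk (vvec n α) B).re}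
      (1 - Real.cos (2 * n * α) * Real.sin (2 * α)) := by
  have hn' : (1 : ℝ) ≤ n := by exact_mod_cast hn
  have hαn : α ≤ n * α := le_mul_of_one_le_left hα.le hn'
  have hc : 0 < Real.cos (n * α) := Real.cos_pos_of_mem_Ioo ⟨by linarith, by linarith⟩
  have hs : 0 < Real.sin (n * α) := Real.sin_pos_of_pos_of_lt_pi (by linarith) (by linarith)
  have hC : 0 < Real.cos (2 * n * α) := Real.cos_pos_of_mem_Ioo ⟨by linarith, by linarith⟩
  have hc2 : 0 < Real.cos (2 * α) := Real.cos_pos_of_mem_Ioo ⟨by linarith, by linarith⟩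
  have hs2 : 0 < Real.sin (2 * α) := Real.sin_pos_of_pos_of_lt_pi (by linarith) (by linarith)
  have hCn : Real.cos (2 * n * α) = Real.cos (n * α) ^ 2 - Real.sin (n * α) ^ 2 := by
    rw [mul_assoc, Real.cos_two_mul']
  rw [hCn] at hC hreg ⊢
  rw [Real.cos_two_mul'] at hc2 hreg
  rw [Real.sin_two_mul] at hs2 hreg ⊢
  have h1 := Real.sin_sq_add_cos_sq (n * α)
  have h2 := Real.sin_sq_add_cos_sq α
  unfold uvec vvec
  generalize Real.cos (n * α) = cn at *
  generalize Real.sin (n * α) = sn at *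
  generalize Real.cos α = c at *
  generalize Real.sin α = s at *
  convert isGreatest_unambiguous_discrimination (u₁ := cn * c) (u₂ := sn * s) (v₁ := cn * s)
    (v₂ := -(sn * c)) ?_ ?_ ?_ ?_ using 1
  · linear_combination (-sn ^ 2 - cn ^ 2) * h2 - h1
  · have : cn * c * -(sn * c) - sn * s * (cn * s) = -(cn * sn) := by
      linear_combination -(cn * sn) * h2
    rw [this]
    exact neg_ne_zero.2 (by positivity)
  · nlinarith [mul_pos hC hs2]
  · nlinarith [mul_pos hC hc2, sq_nonneg (s - c), sq_nonneg sn, sq_nonneg cn,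
      mul_nonneg hC.le (sq_nonneg (s - c))]
  · linear_combination hreg / 2 - (c ^ 2 + s ^ 2) / 2 * h1 - h2 / 2
end
end
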